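/- Let R₀ > 0 and let B ∈ C¹(𝓑(0,4R₀); ℝ^{d×d}) satisfy: (H) there exists C₀ > 0 with sup_{𝓑(x,r)} |∇B| ≤ (C₀/r) ⨍_{𝓑(x,r)} |B| for every ball 𝓑(x,r) ⊂ 𝓑(0,4R₀); and (H′) sup_{𝓑(x,R₀/2)} |B| > 4 R₀⁻² for every x ∈ 𝓑(0,R₀). Then there exist constants C, c, κ₀ > 0, depending only on C₀, such that for all x, y ∈ 𝓑(0,R₀): m(y,B) ≤ C (1 + |x−y| m(x,B))^{κ₀} m(x,B), and m(y,B) ≥ c · m(x,B) / (1 + |x−y| m(x,B))^{κ₀/(κ₀+1)}. -/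

import Mathlib

open MeasureTheory Metric Set
open scoped ENNReal NNReal ComplexConjugate

noncomputable section

/-- `ℝ^d` with the Euclidean norm. -/
abbrev Euc (d : ℕ) := EuclideanSpace ℝ (Fin d)

/-- The auxiliary function `m(·, B)` of Shen: `1/m(x,B) = sup{ r > 0 : sup_{𝓑(x,r)} |B| ≤ r⁻² }`,
formulated in terms of the pointwise norm `nB = |B(·)|`. -/
noncomputable def mfun {d : ℕ} (nB : Euc d → ℝ) (x : Euc d) : ℝ :=
  (sSup {r : ℝ | 0 < r ∧ ∀ y ∈ ball x r, nB y ≤ (r ^ 2)⁻¹})⁻¹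

/-- Condition (H): `sup_{𝓑(x,r)} |∇B| ≤ (C₀/r) ⨍_{𝓑(x,r)} |B|` for every ball
`𝓑(x,r) ⊆ 𝓑(0, 4R₀)`. -/
def CondH {d : ℕ} (C₀ R₀ : ℝ) (B : Euc d → Fin d → Fin d → ℝ) : Prop :=
  ∀ (x : Euc d) (r : ℝ), 0 < r → ball x r ⊆ ball (0 : Euc d) (4 * R₀) →
    ∀ y ∈ ball x r, ‖fderiv ℝ B y‖ ≤ C₀ / r * ⨍ z in ball x r, ‖B z‖

/-- Condition (H′): `sup_{𝓑(x, R₀/2)} |B| > 4 R₀⁻²` for every `x ∈ 𝓑(0, R₀)`. -/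
def CondH' {d : ℕ} (R₀ : ℝ) (B : Euc d → Fin d → Fin d → ℝ) : Prop :=
  ∀ x ∈ ball (0 : Euc d) R₀, ∃ y ∈ ball x (R₀ / 2), 4 / R₀ ^ 2 < ‖B y‖

lemma setAverage_ball_norm_le {d : ℕ} {F : Type*} [NormedAddCommGroup F] {B : Euc d → F}
    {x : Euc d} {r M : ℝ} (hM : 0 ≤ M) (h : ∀ z ∈ ball x r, ‖B z‖ ≤ M) :
    ⨍ z in ball x r, ‖B z‖ ≤ M := by
  have h1 : ‖∫ z in ball x r, ‖B z‖‖ ≤ M * volume.real (ball x r) :=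
    norm_setIntegral_le_of_norm_le_const measure_ball_lt_top fun z hz => by
      simpa using h z hz
  rw [setAverage_eq, smul_eq_mul]
  rcases (measureReal_nonneg (μ := volume) (s := ball x r)).eq_or_lt with h0 | h0
  · simp [← h0, hM]
  · rw [inv_mul_le_iff₀ h0, mul_comm]
    exact (Real.le_norm_self _).trans h1

lemma CondH.norm_le_two_mul {d : ℕ} {C₀ R₀ : ℝ} {B : Euc d → Fin d → Fin d → ℝ} (hC₀ : 0 < C₀)
    (hB : DifferentiableOn ℝ B (ball 0 (4 * R₀))) (hH : CondH C₀ R₀ B) {x : Euc d}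
    {r q N K : ℝ} (hr : 0 < r) (hsub : ball x r ⊆ ball 0 (4 * R₀)) (hq0 : 0 < q) (hq1 : q ≤ 1)
    (hq : (1 - q) * C₀ ≤ 1 / 2) (hK : ∀ z ∈ ball x r, ‖B z‖ ≤ K)
    (hN : ∀ z ∈ ball x (q * r), ‖B z‖ ≤ N) : ∀ y ∈ ball x r, ‖B y‖ ≤ 2 * N := by
  set M := sSup ((fun z => ‖B z‖) '' ball x r)
  have hbdd : BddAbove ((fun z => ‖B z‖) '' ball x r) :=
    ⟨K, by rintro _ ⟨z, hz, rfl⟩; exact hK z hz⟩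
  have hM : ∀ z ∈ ball x r, ‖B z‖ ≤ M := fun z hz => le_csSup hbdd ⟨z, hz, rfl⟩
  have hM0 : 0 ≤ M := (norm_nonneg _).trans (hM x (mem_ball_self hr))
  have hder : ∀ z ∈ ball x r, ‖fderiv ℝ B z‖ ≤ C₀ / r * M := fun z hz =>
    (hH x r hr hsub z hz).trans
      (mul_le_mul_of_nonneg_left (setAverage_ball_norm_le hM0 hM) (by positivity))
  have hstep : ∀ y ∈ ball x r, ‖B y‖ ≤ N + M / 2 := by
    intro y hy
    have hyx : ‖y - x‖ < r := by rwa [mem_ball, dist_eq_norm] at hy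
    have hz : x + q • (y - x) ∈ ball x (q * r) := by
      rw [mem_ball, dist_eq_norm, add_sub_cancel_left, norm_smul, Real.norm_of_nonneg hq0.le]
      gcongr
    have hz' : x + q • (y - x) ∈ ball x r :=
      ball_subset_ball (by nlinarith) hz
    have hmv := (convex_ball x r).norm_image_sub_le_of_norm_fderiv_le (𝕜 := ℝ) (f := B)
      (fun z hz => (hB z (hsub hz)).differentiableAt (isOpen_ball.mem_nhds (hsub hz))) hder hz' hy
    have he : ‖y - (x + q • (y - x))‖ ≤ (1 - q) * r := by
      have : y - (x + q • (y - x)) = (1 - q) • (y - x) := by module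
      rw [this, norm_smul, Real.norm_of_nonneg (by linarith)]
      exact mul_le_mul_of_nonneg_left hyx.le (by linarith)
    have h2 : C₀ / r * M * ‖y - (x + q • (y - x))‖ ≤ M / 2 := by
      calc _ ≤ C₀ / r * M * ((1 - q) * r) := by gcongr
        _ = ((1 - q) * C₀) * M := by field_simp
        _ ≤ 1 / 2 * M := by gcongr
        _ = M / 2 := by ring
    have h3 := norm_sub_norm_le (B y) (B (x + q • (y - x)))
    have h4 := hN _ hz
    linarith
  have hMle : M ≤ N + M / 2 :=
    csSup_le ((nonempty_ball.2 hr).image _) (by rintro _ ⟨z, hz, rfl⟩; exact hstep z hz)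
  intro y hy
  have := hM y hy
  linarith

lemma CondH.norm_le_two_pow_mul {d : ℕ} {C₀ R₀ : ℝ} {B : Euc d → Fin d → Fin d → ℝ} (hC₀ : 0 < C₀)
    (hB : DifferentiableOn ℝ B (ball 0 (4 * R₀))) (hH : CondH C₀ R₀ B) {x : Euc d}
    {q N K : ℝ} (hq0 : 0 < q) (hq1 : q ≤ 1) (hq : (1 - q) * C₀ ≤ 1 / 2) (k : ℕ) {r : ℝ}
    (hr : 0 < r) (hsub : ball x r ⊆ ball 0 (4 * R₀)) (hK : ∀ z ∈ ball x r, ‖B z‖ ≤ K)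
    (hN : ∀ z ∈ ball x (q ^ k * r), ‖B z‖ ≤ N) : ∀ y ∈ ball x r, ‖B y‖ ≤ 2 ^ k * N := by
  induction k generalizing r with
  | zero => simpa using hN
  | succ k ih =>
    have hss : ball x (q * r) ⊆ ball x r := ball_subset_ball (by nlinarith)
    have := ih (r := q * r) (by positivity) (hss.trans hsub) (fun z hz => hK z (hss hz))
      (by rwa [← mul_assoc, ← pow_succ])
    rw [pow_succ', mul_assoc]
    exact hH.norm_le_two_mul hC₀ hB hr hsub hq0 hq1 hq hK this

/-- Condition (H) forces `sup_{𝓑(x,r)} |B|` to grow at most polynomially in `r`. -/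
lemma exists_rpow_growth {C₀ : ℝ} (hC₀ : 0 < C₀) : ∃ κ > (0 : ℝ), ∀ {d : ℕ} {R₀ : ℝ}
    {B : Euc d → Fin d → Fin d → ℝ}, DifferentiableOn ℝ B (ball 0 (4 * R₀)) → CondH C₀ R₀ B →
    ∀ {x : Euc d} {s r N K : ℝ}, 0 < s → s ≤ r → ball x r ⊆ ball 0 (4 * R₀) →
      (∀ z ∈ ball x r, ‖B z‖ ≤ K) → (∀ z ∈ ball x s, ‖B z‖ ≤ N) →
      ∀ y ∈ ball x r, ‖B y‖ ≤ 2 * (r / s) ^ κ * N := by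
  have hp1 : (1 : ℝ) < (2 * C₀ + 1) / (2 * C₀) := by
    rw [one_lt_div (by positivity)]; linarith
  set p := (2 * C₀ + 1) / (2 * C₀) with hp
  have hp0 : 0 < p := by linarith
  refine ⟨Real.logb p 2, Real.logb_pos hp1 (by norm_num), ?_⟩
  intro d R₀ B hB hH x s r N K hs hsr hsub hK hN y hy
  have hr : 0 < r := hs.trans_le hsr
  have hN0 : 0 ≤ N := (norm_nonneg _).trans (hN x (mem_ball_self hs))
  obtain ⟨k, hk1, hk2⟩ := exists_nat_pow_near ((one_le_div hs).2 hsr) hp1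
  have hq : (1 - p⁻¹) * C₀ ≤ 1 / 2 := by
    rw [hp, inv_div, one_sub_div (by positivity), div_mul_eq_mul_div,
      div_le_div_iff₀ (by positivity) (by norm_num)]
    linarith
  have hmem : ∀ z ∈ ball x (p⁻¹ ^ (k + 1) * r), ‖B z‖ ≤ N := fun z hz =>
    hN z (ball_subset_ball (by
      rw [inv_pow, inv_mul_le_iff₀ (by positivity)]
      exact ((div_lt_iff₀ hs).1 hk2).le) hz)
  refine (hH.norm_le_two_pow_mul hC₀ hB (inv_pos.2 hp0) (inv_le_one_of_one_le₀ hp1.le) hq (k + 1)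
    hr hsub hK hmem y hy).trans ?_
  have h2 : (2 : ℝ) ^ k ≤ (r / s) ^ Real.logb p 2 := by
    calc (2 : ℝ) ^ k = (p ^ Real.logb p 2) ^ k := by
          rw [Real.rpow_logb hp0 hp1.ne' (by norm_num)]
      _ = (p ^ k) ^ Real.logb p 2 := by
          rw [← Real.rpow_natCast, ← Real.rpow_natCast, ← Real.rpow_mul hp0.le,
            ← Real.rpow_mul hp0.le, mul_comm]
      _ ≤ _ := Real.rpow_le_rpow (by positivity) hk1 (Real.logb_pos hp1 (by norm_num)).le
  rw [pow_succ']
  gcongr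

lemma CondH'.bddAbove_radii {d : ℕ} {R₀ : ℝ} {B : Euc d → Fin d → Fin d → ℝ} (hR₀ : 0 < R₀)
    (hH' : CondH' R₀ B) {x : Euc d} (hx : x ∈ ball 0 R₀) :
    R₀ / 2 ∈ upperBounds {r : ℝ | 0 < r ∧ ∀ y ∈ ball x r, ‖B y‖ ≤ (r ^ 2)⁻¹} := by
  rintro r ⟨hr, h⟩
  by_contra! hlt
  obtain ⟨y, hy, hBy⟩ := hH' x hx
  have h1 := h y (ball_subset_ball hlt.le hy)
  have h2 : (r ^ 2)⁻¹ ≤ ((R₀ / 2) ^ 2)⁻¹ := by gcongr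
  have h3 : ((R₀ / 2) ^ 2)⁻¹ = 4 / R₀ ^ 2 := by field_simp; norm_num
  linarith

lemma nonempty_radii {d : ℕ} {f : Euc d → ℝ} {x : Euc d} (hf : ContinuousAt f x) :
    {r : ℝ | 0 < r ∧ ∀ y ∈ ball x r, f y ≤ (r ^ 2)⁻¹}.Nonempty := by
  obtain ⟨ε, hε, h⟩ := Metric.eventually_nhds_iff_ball.1
    (hf.eventually (eventually_le_nhds (lt_add_one (f x))))
  set L := max 1 (f x + 1)
  have hL : 1 ≤ L := le_max_left _ _
  have hr : 0 < min ε L⁻¹ := by positivity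
  refine ⟨min ε L⁻¹, hr, fun y hy => ?_⟩
  calc f y ≤ f x + 1 := h y (ball_subset_ball (min_le_left _ _) hy)
    _ ≤ L := le_max_right _ _
    _ ≤ L ^ 2 := by nlinarith
    _ = ((L⁻¹) ^ 2)⁻¹ := by simp
    _ ≤ _ := by gcongr; exact min_le_right _ _

lemma le_of_mem_ball_sSup_radii {d : ℕ} {f : Euc d → ℝ} {x : Euc d}
    (hne : {r : ℝ | 0 < r ∧ ∀ y ∈ ball x r, f y ≤ (r ^ 2)⁻¹}.Nonempty)
    (hb : BddAbove {r : ℝ | 0 < r ∧ ∀ y ∈ ball x r, f y ≤ (r ^ 2)⁻¹}) :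
    ∀ y ∈ ball x (sSup {r : ℝ | 0 < r ∧ ∀ y ∈ ball x r, f y ≤ (r ^ 2)⁻¹}),
      f y ≤ ((sSup {r : ℝ | 0 < r ∧ ∀ y ∈ ball x r, f y ≤ (r ^ 2)⁻¹}) ^ 2)⁻¹ := by
  intro y hy
  set S := {r : ℝ | 0 < r ∧ ∀ y ∈ ball x r, f y ≤ (r ^ 2)⁻¹}
  obtain ⟨r₀, hr₀⟩ := hne
  have hpos : 0 < sSup S := hr₀.1.trans_le (le_csSup hb hr₀)
  have hcont : Filter.Tendsto (fun r : ℝ => (r ^ 2)⁻¹) (nhdsWithin (sSup S) (Iio (sSup S)))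
      (nhds ((sSup S ^ 2)⁻¹)) :=
    ((continuousAt_id.pow 2).inv₀ (by simpa using hpos.ne')).mono_left nhdsWithin_le_nhds
  refine ge_of_tendsto hcont ?_
  filter_upwards [Ioo_mem_nhdsLT (max_lt hy hpos)] with r hr
  obtain ⟨r', hr', hlt⟩ := exists_lt_of_lt_csSup ⟨r₀, hr₀⟩ hr.2
  have h0 : 0 < r := (le_max_right _ _).trans_lt hr.1
  calc f y ≤ (r' ^ 2)⁻¹ := hr'.2 y (((le_max_left _ _).trans_lt hr.1).trans hlt)
    _ ≤ (r ^ 2)⁻¹ := by gcongr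

lemma mfun_pos_and_le {C₀ : ℝ} (hC₀ : 0 < C₀) : ∃ C ≥ (1 : ℝ), ∃ κ > (0 : ℝ), ∀ {d : ℕ} {R₀ : ℝ},
    0 < R₀ → ∀ {B : Euc d → Fin d → Fin d → ℝ}, ContDiffOn ℝ 1 B (ball (0 : Euc d) (4 * R₀)) →
      CondH C₀ R₀ B → CondH' R₀ B →
        ∀ x ∈ ball (0 : Euc d) R₀, ∀ y ∈ ball (0 : Euc d) R₀,
          0 < mfun (fun z => ‖B z‖) x ∧
          mfun (fun z => ‖B z‖) y ≤
              C * (1 + dist x y * mfun (fun z => ‖B z‖) x) ^ κ * mfun (fun z => ‖B z‖) x := by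
  obtain ⟨κ, hκ, hgrow⟩ := exists_rpow_growth hC₀
  refine ⟨√2, Real.one_le_sqrt.2 (by norm_num), κ / 2, by positivity, ?_⟩
  intro d R₀ hR₀ B hB hH hH' x hx y hy
  have hbx : _ ∈ upperBounds _ := hH'.bddAbove_radii hR₀ hx
  have hby : _ ∈ upperBounds _ := hH'.bddAbove_radii hR₀ hy
  have hx4 : x ∈ ball (0 : Euc d) (4 * R₀) := ball_subset_ball (by linarith) hx
  have hnx := nonempty_radii (f := fun z => ‖B z‖)
    (hB.continuousOn.continuousAt (isOpen_ball.mem_nhds hx4)).norm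
  have hle := le_of_mem_ball_sSup_radii hnx ⟨_, hbx⟩
  have hrle := csSup_le hnx hbx
  unfold mfun
  set r := sSup {r : ℝ | 0 < r ∧ ∀ y ∈ ball x r, ‖B y‖ ≤ (r ^ 2)⁻¹}
  have hr : 0 < r := by
    obtain ⟨r₀, hr₀⟩ := hnx
    exact hr₀.1.trans_le (le_csSup ⟨_, hbx⟩ hr₀)
  refine ⟨inv_pos.2 hr, ?_⟩
  have hx' : dist x 0 < R₀ := hx
  have hy' : dist y 0 < R₀ := hy
  have hxy : dist x y < 2 * R₀ := by
    have := dist_triangle_right x y 0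
    linarith
  have hsub : ball x (dist x y + r) ⊆ closedBall 0 (7 / 2 * R₀) :=
    (ball_subset_ball' (ε₂ := 7 / 2 * R₀) (by linarith)).trans ball_subset_closedBall
  have hsub4 : closedBall (0 : Euc d) (7 / 2 * R₀) ⊆ ball 0 (4 * R₀) :=
    closedBall_subset_ball (by linarith)
  obtain ⟨K, hK⟩ := (isCompact_closedBall (0 : Euc d) (7 / 2 * R₀)).exists_bound_of_continuousOn
    (hB.continuousOn.mono hsub4)
  have hg := hgrow (hB.differentiableOn one_ne_zero) hH hr
    (by linarith [dist_nonneg (x := x) (y := y)])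
    (hsub.trans hsub4) (fun z hz => hK z (hsub hz)) hle
  have hu : (dist x y + r) / r = 1 + dist x y * r⁻¹ := by field_simp; ring
  rw [hu] at hg
  have hu1 : 1 ≤ 1 + dist x y * r⁻¹ := by
    have : 0 ≤ dist x y * r⁻¹ := by positivity
    linarith
  set u := 1 + dist x y * r⁻¹
  have hu0 : 0 < u := by linarith
  have hT1 : 1 ≤ √2 * u ^ (κ / 2) :=
    one_le_mul_of_one_le_of_one_le (Real.one_le_sqrt.2 (by norm_num))
      (Real.one_le_rpow hu1 (by positivity))
  have hT2 : (√2 * u ^ (κ / 2)) ^ 2 = 2 * u ^ κ := by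
    rw [mul_pow, Real.sq_sqrt (by norm_num), ← Real.rpow_natCast (u ^ (κ / 2)) 2,
      ← Real.rpow_mul hu0.le]
    congr 2
    push_cast
    ring
  set T := √2 * u ^ (κ / 2)
  have hT0 : 0 < T := by linarith
  have hmem : r / T ∈ {r : ℝ | 0 < r ∧ ∀ z ∈ ball y r, ‖B z‖ ≤ (r ^ 2)⁻¹} := by
    refine ⟨by positivity, fun z hz => ?_⟩
    have hz' : z ∈ ball x (dist x y + r) := by
      have h1 : dist z y < r / T := hz
      have h2 : r / T ≤ r := div_le_self hr.le hT1
      have h3 := dist_triangle z y x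
      rw [dist_comm y x] at h3
      rw [mem_ball]
      linarith
    refine (hg z hz').trans_eq ?_
    rw [← hT2, div_pow, inv_div, div_eq_mul_inv]
  rw [show T * r⁻¹ = (r / T)⁻¹ by rw [inv_div, div_eq_mul_inv]]
  have : 0 < r / T := by positivity
  exact inv_anti₀ this (le_csSup ⟨_, hby⟩ hmem)

lemma div_rpow_le_of_le_mul_rpow {a b D C κ : ℝ} (ha : 0 < a) (hb : 0 < b) (hD : 0 ≤ D)
    (hC : 1 ≤ C) (hκ : 0 < κ) (h : a ≤ C * (1 + D * b) ^ κ * b) :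
    (C * 2 ^ κ)⁻¹ * a / (1 + D * a) ^ (κ / (κ + 1)) ≤ b := by
  have hC' : 1 ≤ C * 2 ^ κ :=
    one_le_mul_of_one_le_of_one_le hC (Real.one_le_rpow (by norm_num) hκ.le)
  have hu1 : 1 ≤ 1 + D * a := by
    have : 0 ≤ D * a := by positivity
    linarith
  have hlam : a / b ≤ C * (1 + D * b) ^ κ := (div_le_iff₀ hb).2 h
  have key : a / b ≤ C * 2 ^ κ * (1 + D * a) ^ (κ / (κ + 1)) := by
    rcases le_total (D * b) 1 with h1 | h1
    · have h2 : (1 : ℝ) ≤ (1 + D * a) ^ (κ / (κ + 1)) := Real.one_le_rpow hu1 (by positivity)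
      calc a / b ≤ C * (1 + D * b) ^ κ := hlam
        _ ≤ C * 2 ^ κ := by gcongr; linarith
        _ ≤ _ := le_mul_of_one_le_right (by positivity) h2
    · have h2 : a / b ≤ C * 2 ^ κ * ((1 + D * a) ^ κ / (a / b) ^ κ) := by
        calc a / b ≤ C * (1 + D * b) ^ κ := hlam
          _ ≤ C * (2 * ((1 + D * a) / (a / b))) ^ κ := by
            gcongr
            have : (1 + D * a) / (a / b) = b / a + D * b := by field_simp
            rw [this]
            have : 0 < b / a := by positivity
            linarith
          _ = _ := by
            rw [Real.mul_rpow (by positivity) (by positivity),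
              Real.div_rpow (by positivity) (by positivity), mul_assoc]
      have h3 : (a / b) ^ (κ + 1) ≤ C * 2 ^ κ * (1 + D * a) ^ κ := by
        rw [Real.rpow_add_one (by positivity)]
        calc (a / b) ^ κ * (a / b)
            ≤ (a / b) ^ κ * (C * 2 ^ κ * ((1 + D * a) ^ κ / (a / b) ^ κ)) := by gcongr
          _ = _ := by
            have : (a / b) ^ κ ≠ 0 := by positivity
            field_simp
      rw [← Real.rpow_le_rpow_iff (z := κ + 1) (by positivity) (by positivity) (by positivity),
        Real.mul_rpow (by positivity) (by positivity), ← Real.rpow_mul (by positivity) (κ / (κ + 1)),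
        div_mul_cancel₀ _ (by positivity)]
      refine h3.trans ?_
      gcongr
      exact Real.self_le_rpow_of_one_le hC' (by linarith)
  rw [div_le_iff₀ (by positivity), inv_mul_le_iff₀ (by positivity)]
  rw [div_le_iff₀ hb] at key
  linarith

/-- If `B ∈ C¹(𝓑(0,4R₀); ℝ^{d×d})` satisfies (H) and (H′), then there
are constants `C, c, κ₀ > 0`, depending only on `C₀` (and the dimension), such that for all
`x, y ∈ 𝓑(0,R₀)`: `m(y,B) ≤ C (1 + |x−y| m(x,B))^{κ₀} m(x,B)` and
`m(y,B) ≥ c m(x,B) / (1 + |x−y| m(x,B))^{κ₀/(κ₀+1)}`. -/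
theorem stmt_9 {d : ℕ} (C₀ : ℝ) (hC₀ : 0 < C₀) :
    ∃ C > (0 : ℝ), ∃ c > (0 : ℝ), ∃ κ₀ > (0 : ℝ), ∀ R₀ : ℝ, 0 < R₀ →
      ∀ B : Euc d → Fin d → Fin d → ℝ, ContDiffOn ℝ 1 B (ball (0 : Euc d) (4 * R₀)) →
        CondH C₀ R₀ B → CondH' R₀ B →
        ∀ x ∈ ball (0 : Euc d) R₀, ∀ y ∈ ball (0 : Euc d) R₀,
          mfun (fun z => ‖B z‖) y ≤
              C * (1 + dist x y * mfun (fun z => ‖B z‖) x) ^ κ₀ *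
                mfun (fun z => ‖B z‖) x ∧
            c * mfun (fun z => ‖B z‖) x /
                (1 + dist x y * mfun (fun z => ‖B z‖) x) ^ (κ₀ / (κ₀ + 1)) ≤
              mfun (fun z => ‖B z‖) y := by
  obtain ⟨C, hC, κ, hκ, h⟩ := mfun_pos_and_le hC₀
  refine ⟨C, by linarith, (C * 2 ^ κ)⁻¹, by positivity, κ, hκ, ?_⟩
  intro R₀ hR₀ B hB hH hH' x hx y hy
  obtain ⟨hmx, hyx⟩ := h hR₀ hB hH hH' x hx y hy
  obtain ⟨hmy, hxy⟩ := h hR₀ hB hH hH' y hy x hx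
  rw [dist_comm y x] at hxy
  exact ⟨hyx, div_rpow_le_of_le_mul_rpow hmx hmy dist_nonneg hC hκ hxy⟩
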